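/- arXiv:2410.13729 — 4 statements merged into one kernel-verified Lean document; each statement's English description precedes it below -/
import Mathlib

section
/- Let i be an odd integer with i ≡ 3 (mod 4) and i ≥ 7 (so that (i+1)/2 is even), and set B(i) = {(i+1)/2 + 1, (i+1)/2 + 3, …, i}. Then S(i) = ⋂_{j ∈ B(i)} T(j), and this is a factorization of S(i) into irreducibles; that is, each T(j) is irreducible and S(i) ≠ ⋂_{j ∈ J} T(j) for every proper subset J of B(i). -/
/-- A numerical semigroup: a submonoid of `(ℕ, +)` with finite complement. -/
structure NumericalSemigroup where
  carrier : Set ℕ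
  zero_mem : 0 ∈ carrier
  add_mem : ∀ ⦃a b : ℕ⦄, a ∈ carrier → b ∈ carrier → a + b ∈ carrier
  cofinite : (carrierᶜ : Set ℕ).Finite

/-- A numerical semigroup is irreducible if it is not the intersection of two
numerical semigroups properly containing it. -/
def NumericalSemigroup.Irred (S : NumericalSemigroup) : Prop :=
  ¬ ∃ A B : NumericalSemigroup,
      S.carrier ⊂ A.carrier ∧ S.carrier ⊂ B.carrier ∧
      S.carrier = A.carrier ∩ B.carrier

/-- `F : Fin n → NumericalSemigroup` is a factorization of `S` (of length `n`)
into irreducibles: each factor is irreducible, `S` is the intersection of the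
factors, and the intersection cannot be refined (no proper subfamily has
intersection `S`). -/
def IsFactorization (S : NumericalSemigroup) {n : ℕ}
    (F : Fin n → NumericalSemigroup) : Prop :=
  (∀ j, (F j).Irred) ∧
  S.carrier = ⋂ j, (F j).carrier ∧
  ∀ J : Set (Fin n), J ≠ Set.univ → S.carrier ≠ ⋂ j ∈ J, (F j).carrier

/-- `S` admits a factorization into irreducibles of length `n`. -/
def HasFactorizationOfLength (S : NumericalSemigroup) (n : ℕ) : Prop :=
  ∃ F : Fin n → NumericalSemigroup, IsFactorization S F

/-- The set of lengths `Lᵐ(S)` of factorizations of `S` into irreducibles. -/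
def LengthSet (S : NumericalSemigroup) : Set ℕ :=
  {n | HasFactorizationOfLength S n}

/-- The underlying set of `T(m) = {0} ∪ {(m+1)/2, …, m-1} ∪ {m+1, m+2, …}`. -/
def Tset (m : ℕ) : Set ℕ :=
  {0} ∪ Set.Icc ((m + 1) / 2) (m - 1) ∪ Set.Ici (m + 1)

/-- The underlying set of the numerical semigroup `⟨2, m⟩` generated by `2` and `m`. -/
def gen2 (m : ℕ) : Set ℕ := {n | ∃ a b : ℕ, n = 2 * a + m * b}

/-- The underlying set of `S(i) = ⟨2, i⟩ ∩ T(i)`. -/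
def Sset (i : ℕ) : Set ℕ := gen2 i ∩ Tset i

/-- The set of special gaps of `S`: gaps `g` such that `S ∪ {g}` is again a
numerical semigroup. -/
def SpecialGaps (S : NumericalSemigroup) : Set ℕ :=
  {g | g ∉ S.carrier ∧ ∃ T : NumericalSemigroup, T.carrier = insert g S.carrier}

theorem mem_Tset {m n : ℕ} : n ∈ Tset m ↔ n = 0 ∨ ((m + 1) / 2 ≤ n ∧ n ≠ m) := by
  simp only [Tset, Set.mem_union, Set.mem_singleton_iff, Set.mem_Icc, Set.mem_Ici]
  omega

theorem mem_gen2 {m n : ℕ} (hm : Odd m) : n ∈ gen2 m ↔ Even n ∨ m ≤ n := by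
  constructor
  · rintro ⟨a, b, rfl⟩
    rcases b with _ | b
    · simp
    · right
      nlinarith
  · intro h
    obtain ⟨a, ha⟩ | hn := Nat.even_or_odd n
    · exact ⟨a, 0, by omega⟩
    · obtain ⟨c, hc⟩ := hn
      obtain ⟨d, hd⟩ := hm
      have hle : m ≤ n := h.resolve_left fun ⟨e, he⟩ => by omega
      exact ⟨(n - m) / 2, 1, by omega⟩

/-- A numerical semigroup properly containing `Tset m` contains `m`. -/
theorem NumericalSemigroup.mem_of_Tset_ssubset {m : ℕ} {A : NumericalSemigroup}
    (h : Tset m ⊂ A.carrier) : m ∈ A.carrier := by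
  obtain ⟨x, hxA, hxT⟩ := Set.exists_of_ssubset h
  rw [mem_Tset] at hxT
  obtain rfl | hxm := eq_or_ne x m
  · exact hxA
  · have hsub : m - x ∈ A.carrier := h.subset (mem_Tset.2 (by omega))
    have := A.add_mem hsub hxA
    rwa [Nat.sub_add_cancel (by omega)] at this

theorem NumericalSemigroup.irred_of_carrier_eq_Tset {m : ℕ} (hm : m ≠ 0)
    {T : NumericalSemigroup} (hT : T.carrier = Tset m) : T.Irred := by
  rintro ⟨A, B, hA, hB, hAB⟩
  rw [hT] at hA hB hAB
  have hmem : m ∈ Tset m :=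
    hAB ▸ ⟨mem_of_Tset_ssubset hA, mem_of_Tset_ssubset hB⟩
  rw [mem_Tset] at hmem
  omega

/-- For odd `i ≡ 3 (mod 4)`, `i ≥ 7`, with
`B(i) = {(i+1)/2 + 1, (i+1)/2 + 3, …, i}`, one has `S(i) = ⋂_{j ∈ B(i)} T(j)`,
each `T(j)` is irreducible, and the intersection cannot be refined. -/
theorem factorization_Si_full_case_even (i : ℕ) (hi : i % 4 = 3) (hi7 : 7 ≤ i) :
    (Sset i = ⋂ j ∈ {j : ℕ | ∃ m ≤ (i - 3) / 4, j = (i + 1) / 2 + 1 + 2 * m}, Tset j) ∧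
    (∀ j ∈ {j : ℕ | ∃ m ≤ (i - 3) / 4, j = (i + 1) / 2 + 1 + 2 * m},
      ∀ T : NumericalSemigroup, T.carrier = Tset j → T.Irred) ∧
    (∀ J : Set ℕ, J ⊂ {j : ℕ | ∃ m ≤ (i - 3) / 4, j = (i + 1) / 2 + 1 + 2 * m} →
      Sset i ≠ ⋂ j ∈ J, Tset j) := by
  have hi_odd : Odd i := Nat.odd_iff.2 (by omega)
  refine ⟨?_, ?_, ?_⟩
  · ext n
    simp only [Sset, Set.mem_inter_iff, mem_gen2 hi_odd, mem_Tset,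
      Set.mem_iInter, Set.mem_ofPred_eq, Nat.even_iff]
    constructor
    · rintro ⟨hgen, hT⟩ j ⟨m, hm, rfl⟩
      omega
    · intro h
      have hlast := h i ⟨(i - 3) / 4, le_rfl, by omega⟩
      refine ⟨?_, hlast⟩
      by_contra! hn
      have hself := h n ⟨(n - ((i + 1) / 2 + 1)) / 2, by omega, by omega⟩
      omega
  · rintro j ⟨m, hm, rfl⟩ T hT
    exact NumericalSemigroup.irred_of_carrier_eq_Tset (by omega) hT
  · intro J hJ heq
    obtain ⟨j, ⟨m, hm, rfl⟩, hjJ⟩ := Set.exists_of_ssubset hJ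
    have hmem : (i + 1) / 2 + 1 + 2 * m ∈ Sset i := by
      rw [heq]
      refine Set.mem_iInter₂.2 fun j' hj' => ?_
      obtain ⟨m', hm', hj'_eq⟩ := hJ.subset hj'
      have hne : (i + 1) / 2 + 1 + 2 * m ≠ j' := fun h => hjJ (h ▸ hj')
      rw [mem_Tset]
      omega
    rw [Sset, Set.mem_inter_iff, mem_gen2 hi_odd, mem_Tset, Nat.even_iff] at hmem
    omega
end

section
/- The monoid of numerical semigroups under intersection is not length-factorial: for every integer k ≥ 3, the numerical semigroup S(4k−1) admits two distinct factorizations into irreducibles of the same length k (namely the factorization into the T(j) for j ∈ B(4k−1) and the factorization ⟨2, 2k+3⟩ ∩ ⋂_{m=1}^{k−1} T(2k + 2m + 1), which involve different families of irreducible numerical semigroups). -/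
theorem mem_Tset_odd {n x : ℕ} :
    x ∈ Tset (2 * n + 1) ↔ x = 0 ∨ n + 1 ≤ x ∧ x ≠ 2 * n + 1 := by
  simp only [Tset, Set.mem_union, Set.mem_singleton_iff, Set.mem_Icc, Set.mem_Ici]
  omega

theorem mem_gen2_odd {n x : ℕ} : x ∈ gen2 (2 * n + 1) ↔ Even x ∨ 2 * n + 1 ≤ x := by
  constructor
  · rintro ⟨a, b, rfl⟩
    rcases Nat.eq_zero_or_pos b with rfl | hb
    · exact .inl ⟨a, by ring⟩
    · exact .inr (by nlinarith)
  · intro h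
    rcases Nat.even_or_odd' x with ⟨c, rfl | rfl⟩
    · exact ⟨c, 0, by ring⟩
    · have hc : ¬ Even (2 * c + 1) := by simp
      exact ⟨c - n, 1, by have := h.resolve_left hc; omega⟩

theorem mem_Sset_four_mul_sub_one {k x : ℕ} (hk : 1 ≤ k) :
    x ∈ Sset (4 * k - 1) ↔ x = 0 ∨ 2 * k ≤ x ∧ (Even x ∨ 4 * k ≤ x) := by
  rw [show 4 * k - 1 = 2 * (2 * k - 1) + 1 by omega, Sset, Set.mem_inter_iff, mem_gen2_odd,
    mem_Tset_odd, Nat.even_iff]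
  omega

namespace NumericalSemigroup

/-- `T(2n + 1)` as a numerical semigroup. -/
def oddT (n : ℕ) : NumericalSemigroup where
  carrier := Tset (2 * n + 1)
  zero_mem := mem_Tset_odd.2 (.inl rfl)
  add_mem a b ha hb := by
    rw [mem_Tset_odd] at *
    omega
  cofinite := (Set.finite_Iic (2 * n + 1)).subset fun x hx => by
    rw [Set.mem_compl_iff, mem_Tset_odd] at hx
    rw [Set.mem_Iic]
    omega

/-- `⟨2, 2n + 1⟩` as a numerical semigroup. -/
def oddGen2 (n : ℕ) : NumericalSemigroup where
  carrier := gen2 (2 * n + 1)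
  zero_mem := ⟨0, 0, rfl⟩
  add_mem := by
    rintro _ _ ⟨a, b, rfl⟩ ⟨c, d, rfl⟩
    exact ⟨a + c, b + d, by ring⟩
  cofinite := (Set.finite_Iic (2 * n + 1)).subset fun x hx => by
    rw [Set.mem_compl_iff, mem_gen2_odd] at hx
    rw [Set.mem_Iic]
    omega

theorem mem_oddT {n x : ℕ} : x ∈ (oddT n).carrier ↔ x = 0 ∨ n + 1 ≤ x ∧ x ≠ 2 * n + 1 :=
  mem_Tset_odd

theorem mem_oddGen2 {n x : ℕ} : x ∈ (oddGen2 n).carrier ↔ Even x ∨ 2 * n + 1 ≤ x :=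
  mem_gen2_odd

/-- A numerical semigroup is irreducible if it has a gap `f` such that every gap `x` has
`f - x ∈ S`. -/
theorem Irred.of_forall_gap {S : NumericalSemigroup} {f : ℕ} (hf : f ∉ S.carrier)
    (h : ∀ x ∉ S.carrier, ∃ s ∈ S.carrier, x + s = f) : S.Irred := by
  have key (A : NumericalSemigroup) (hA : S.carrier ⊂ A.carrier) : f ∈ A.carrier := by
    obtain ⟨hsub, x, hxA, hxS⟩ := Set.ssubset_iff_exists.1 hA
    obtain ⟨s, hs, rfl⟩ := h x hxS
    exact A.add_mem hxA (hsub hs)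
  rintro ⟨A, B, hA, hB, hAB⟩
  exact hf (hAB ▸ ⟨key A hA, key B hB⟩)

theorem irred_oddT (n : ℕ) : (oddT n).Irred := by
  refine .of_forall_gap (f := 2 * n + 1) (by rw [mem_oddT]; omega) fun x hx => ?_
  rw [mem_oddT] at hx
  exact ⟨2 * n + 1 - x, by rw [mem_oddT]; omega, by omega⟩

theorem irred_oddGen2_succ (n : ℕ) : (oddGen2 (n + 1)).Irred := by
  refine .of_forall_gap (f := 2 * n + 1) (by rw [mem_oddGen2, Nat.even_iff]; omega) fun x hx => ?_
  rw [mem_oddGen2, Nat.even_iff] at hx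
  exact ⟨2 * n + 1 - x, by rw [mem_oddGen2, Nat.even_iff]; omega, by omega⟩

end NumericalSemigroup

open NumericalSemigroup

theorem IsFactorization.of_forall_exists {S : NumericalSemigroup} {n : ℕ}
    {F : Fin n → NumericalSemigroup} (hirr : ∀ j, (F j).Irred)
    (hS : ∀ x, x ∈ S.carrier ↔ ∀ j, x ∈ (F j).carrier)
    (hne : ∀ j, ∃ x ∉ S.carrier, ∀ i ≠ j, x ∈ (F i).carrier) : IsFactorization S F := by
  refine ⟨hirr, by ext x; simp [hS], fun J hJ h => ?_⟩
  obtain ⟨j, hj⟩ := (Set.ne_univ_iff_exists_notMem J).1 hJ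
  obtain ⟨x, hxS, hx⟩ := hne j
  exact hxS (h ▸ Set.mem_iInter₂.2 fun i hi => hx i fun hij => hj (hij ▸ hi))

theorem isFactorization_oddT {k : ℕ} (hk : 1 ≤ k) {S : NumericalSemigroup}
    (hS : S.carrier = Sset (4 * k - 1)) :
    IsFactorization S fun j : Fin k => oddT (k + j) := by
  refine .of_forall_exists (fun _ => irred_oddT _) (fun x => ?_) fun j => ?_
  · simp only [hS, mem_Sset_four_mul_sub_one hk, mem_oddT, Nat.even_iff]
    refine ⟨fun h j => by omega, fun h => ?_⟩
    have hlast := h ⟨k - 1, by omega⟩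
    by_cases hx : 2 * k < x ∧ x < 4 * k
    · have := h ⟨x / 2 - k, by omega⟩
      simp only at this hlast
      omega
    · simp only at hlast
      omega
  · refine ⟨2 * (k + j) + 1, ?_, fun i hi => ?_⟩
    · rw [hS, mem_Sset_four_mul_sub_one hk, Nat.even_iff]
      omega
    · have := Fin.val_ne_of_ne hi
      rw [mem_oddT]
      omega

/-- The family consisting of `⟨2, 2k + 3⟩` and the `T(2k + 2m + 1)` for `1 ≤ m < k`. -/
def gen2Family (k : ℕ) (j : Fin k) : NumericalSemigroup :=
  if (j : ℕ) = 0 then oddGen2 (k + 1) else oddT (k + j)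

theorem mem_gen2Family {k x : ℕ} {j : Fin k} :
    x ∈ (gen2Family k j).carrier ↔
      (j : ℕ) = 0 ∧ (x % 2 = 0 ∨ 2 * k + 3 ≤ x) ∨
        (j : ℕ) ≠ 0 ∧ (x = 0 ∨ k + j + 1 ≤ x ∧ x ≠ 2 * (k + j) + 1) := by
  unfold gen2Family
  split_ifs with h
  · rw [mem_oddGen2, Nat.even_iff]
    omega
  · rw [mem_oddT]
    omega

theorem isFactorization_gen2Family {k : ℕ} (hk : 2 ≤ k) {S : NumericalSemigroup}
    (hS : S.carrier = Sset (4 * k - 1)) : IsFactorization S (gen2Family k) := by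
  refine .of_forall_exists (fun j => ?_) (fun x => ?_) fun j => ?_
  · unfold gen2Family
    split_ifs
    exacts [irred_oddGen2_succ k, irred_oddT _]
  · simp only [hS, mem_Sset_four_mul_sub_one (show 1 ≤ k by omega), mem_gen2Family, Nat.even_iff]
    refine ⟨fun h j => by omega, fun h => ?_⟩
    have hzero := h ⟨0, by omega⟩
    have hlast := h ⟨k - 1, by omega⟩
    by_cases hx : 2 * k < x ∧ x < 4 * k
    · have := h ⟨x / 2 - k, by omega⟩
      simp only at this hlast hzero
      omega
    · simp only at hlast hzero
      omega
  · refine ⟨2 * (k + j) + 1, ?_, fun i hi => ?_⟩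
    · rw [hS, mem_Sset_four_mul_sub_one (by omega), Nat.even_iff]
      omega
    · have := Fin.val_ne_of_ne hi
      rw [mem_gen2Family]
      omega

theorem range_oddT_carrier {k : ℕ} (hk : 1 ≤ k) :
    Set.range (fun j : Fin k => (oddT (k + j)).carrier) =
      Tset '' {j : ℕ | ∃ m ≤ k - 1, j = 2 * k + 1 + 2 * m} := by
  ext A
  constructor
  · rintro ⟨j, rfl⟩
    exact ⟨2 * (k + j) + 1, ⟨j, by omega, by ring⟩, rfl⟩
  · rintro ⟨_, ⟨m, hm, rfl⟩, rfl⟩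
    exact ⟨⟨m, by omega⟩, congrArg Tset (by simp only; ring)⟩

theorem range_gen2Family_carrier {k : ℕ} (hk : 1 ≤ k) :
    Set.range (fun j => (gen2Family k j).carrier) =
      insert (gen2 (2 * k + 3)) ((fun m => Tset (2 * k + 2 * m + 1)) '' Set.Icc 1 (k - 1)) := by
  ext A
  constructor
  · rintro ⟨j, rfl⟩
    by_cases hj : (j : ℕ) = 0
    · left
      simp only [gen2Family, if_pos hj]
      rfl
    · refine .inr ⟨j, ⟨by omega, by omega⟩, ?_⟩
      simp only [gen2Family, if_neg hj]
      exact congrArg Tset (by ring)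
  · rintro (rfl | ⟨m, ⟨hm, hmk⟩, rfl⟩)
    · exact ⟨⟨0, by omega⟩, rfl⟩
    · refine ⟨⟨m, by omega⟩, ?_⟩
      simp only [gen2Family, if_neg (show m ≠ 0 by omega)]
      exact congrArg Tset (by ring)

/-- `(𝔑, ∩)` is not length-factorial: for every `k ≥ 3`, `S(4k-1)`
admits two distinct factorizations into irreducibles of the same length `k`,
namely into the `T(j)` for `j ∈ B(4k-1) = {2k+1, 2k+3, …, 4k-1}` and into
`⟨2, 2k+3⟩` together with `T(2k + 2m + 1)` for `m ∈ {1, …, k-1}`. -/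
theorem not_length_factorial (k : ℕ) (hk : 3 ≤ k)
    (S : NumericalSemigroup) (hS : S.carrier = Sset (4 * k - 1)) :
    ∃ F G : Fin k → NumericalSemigroup,
      IsFactorization S F ∧ IsFactorization S G ∧
      Set.range (fun j => (F j).carrier) =
        Tset '' {j : ℕ | ∃ m ≤ k - 1, j = 2 * k + 1 + 2 * m} ∧
      Set.range (fun j => (G j).carrier) =
        insert (gen2 (2 * k + 3)) ((fun m => Tset (2 * k + 2 * m + 1)) '' Set.Icc 1 (k - 1)) ∧
      Set.range (fun j => (F j).carrier) ≠ Set.range (fun j => (G j).carrier) := by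
  refine ⟨fun j => oddT (k + j), gen2Family k, isFactorization_oddT (by omega) hS,
    isFactorization_gen2Family (by omega) hS, range_oddT_carrier (by omega),
    range_gen2Family_carrier (by omega), fun h => ?_⟩
  obtain ⟨j, hj⟩ := h.symm ▸ Set.mem_range_self (f := fun j => (gen2Family k j).carrier)
    (⟨0, by omega⟩ : Fin k)
  have h2 : 2 ∈ (gen2Family k ⟨0, by omega⟩).carrier := by simp [mem_gen2Family]
  have := mem_oddT.1 (hj.symm ▸ h2)
  omega
end

section
/- Let i be an odd integer with i ≡ 3 (mod 4) and i ≥ 7 (so that (i+1)/2 is even), let k ∈ {0, 1, …, (i−3)/4}, and set j = (i+1)/2 + 2k + 1. Then the set of special gaps of S(i) that do not belong to T(j) is exactly ([(i+1)/4, (i+1)/4 + k] ∩ 2ℕ) ∪ {j}, where 2ℕ denotes the set of even natural numbers. -/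
/-- For `i = 4 * m + 3`, `S(i)` consists of `0`, the even numbers from `2 * m + 2` on and all
numbers from `4 * m + 4` on. -/
theorem mem_Sset_iff (m n : ℕ) :
    n ∈ Sset (4 * m + 3) ↔ n = 0 ∨ (2 * m + 2 ≤ n ∧ n % 2 = 0) ∨ 4 * m + 4 ≤ n := by
  simp only [Sset, gen2, Tset, Set.mem_inter_iff, Set.mem_ofPred_eq, Set.mem_union,
    Set.mem_singleton_iff, Set.mem_Icc, Set.mem_Ici]
  constructor
  · rintro ⟨⟨a, b, hab⟩, h⟩
    rcases Nat.eq_zero_or_pos b with rfl | hb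
    · omega
    · have : 4 * m + 3 ≤ (4 * m + 3) * b := Nat.le_mul_of_pos_right _ hb
      omega
  · intro h
    refine ⟨?_, by omega⟩
    rcases Nat.even_or_odd' n with ⟨c, hc | hc⟩
    · exact ⟨c, 0, by omega⟩
    · exact ⟨c - (2 * m + 1), 1, by omega⟩

/-- The special gaps of `S(4 * m + 3)` are the even numbers in `[m + 1, 2 * m]` and the odd numbers
in `[2 * m + 3, 4 * m + 3]`. -/
theorem mem_specialGaps_iff (m : ℕ) (S : NumericalSemigroup)
    (hS : S.carrier = Sset (4 * m + 3)) (g : ℕ) :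
    g ∈ SpecialGaps S ↔ (g % 2 = 0 ∧ m + 1 ≤ g ∧ g ≤ 2 * m) ∨
      (g % 2 = 1 ∧ 2 * m + 3 ≤ g ∧ g ≤ 4 * m + 3) := by
  simp only [SpecialGaps, Set.mem_ofPred_eq, hS, mem_Sset_iff]
  constructor
  · rintro ⟨hg, T, hT⟩
    have hmem (n : ℕ) : n ∈ T.carrier ↔
        n = g ∨ n = 0 ∨ (2 * m + 2 ≤ n ∧ n % 2 = 0) ∨ 4 * m + 4 ≤ n := by
      rw [hT, Set.mem_insert_iff, mem_Sset_iff]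
    have hgT := (hmem g).2 (Or.inl rfl)
    have h_double := (hmem _).1 (T.add_mem hgT hgT)
    have h_shift := (hmem _).1 (T.add_mem hgT ((hmem (2 * m + 2)).2 (by omega)))
    omega
  · intro h
    refine ⟨by omega, ⟨insert g (Sset (4 * m + 3)), ?_, ?_, ?_⟩, rfl⟩
    · simp [mem_Sset_iff]
    · intro a b
      simp only [Set.mem_insert_iff, mem_Sset_iff]
      omega
    · rw [← hS]
      exact S.cofinite.subset (Set.compl_subset_compl.2 (Set.subset_insert _ _))

/-- For odd `i ≡ 3 (mod 4)`, `i ≥ 7`, `k ∈ {0, …, (i-3)/4}` and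
`j = (i+1)/2 + 2k + 1`, the special gaps of `S(i)` not in `T(j)` are exactly
`([(i+1)/4, (i+1)/4 + k] ∩ 2ℕ) ∪ {j}`. -/
theorem special_gaps_not_in_Tj (i : ℕ) (hi : i % 4 = 3) (hi7 : 7 ≤ i)
    (k : ℕ) (hk : k ≤ (i - 3) / 4)
    (S : NumericalSemigroup) (hS : S.carrier = Sset i) :
    {g ∈ SpecialGaps S | g ∉ Tset ((i + 1) / 2 + 2 * k + 1)} =
      (Set.Icc ((i + 1) / 4) ((i + 1) / 4 + k) ∩ {n : ℕ | Even n}) ∪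
        {(i + 1) / 2 + 2 * k + 1} := by
  obtain ⟨m, rfl⟩ : ∃ m, i = 4 * m + 3 := ⟨i / 4, by omega⟩
  ext g
  simp only [Set.mem_ofPred_eq, mem_specialGaps_iff m S hS, Tset, Set.mem_union, Set.mem_inter_iff,
    Set.mem_singleton_iff, Set.mem_Icc, Set.mem_Ici, Nat.even_iff]
  omega
end

section
/- Let i be an odd integer with i ≡ 3 (mod 4) and i ≥ 7 (so that (i+1)/2 is even). Then S(i) = ⟨2, i⟩ ∩ T(i) is a factorization of S(i) into irreducibles of length 2 (in particular, S(i) is properly contained in both ⟨2, i⟩ and T(i), both of which are irreducible), and the minimum of the set of lengths of factorizations of S(i) into irreducibles equals 2. -/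
theorem NumericalSemigroup.Irred.of_forall_ssuperset {S : NumericalSemigroup} {f : ℕ}
    (hf : f ∉ S.carrier) (h : ∀ C : NumericalSemigroup, S.carrier ⊂ C.carrier → f ∈ C.carrier) :
    S.Irred := by
  rintro ⟨A, B, hA, hB, hAB⟩
  exact hf (hAB ▸ ⟨h A hA, h B hB⟩)

theorem mem_gen2_iff {m n : ℕ} (hm : m % 2 = 1) : n ∈ gen2 m ↔ n % 2 = 0 ∨ m ≤ n := by
  constructor
  · rintro ⟨a, b, rfl⟩
    rcases Nat.eq_zero_or_pos b with rfl | hb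
    · left
      omega
    · right
      nlinarith
  · intro h
    by_cases hn : n % 2 = 0
    · exact ⟨n / 2, 0, by omega⟩
    · exact ⟨(n - m) / 2, 1, by omega⟩

theorem mem_Tset_iff {m n : ℕ} (hm : 1 ≤ m) :
    n ∈ Tset m ↔ n = 0 ∨ ((m + 1) / 2 ≤ n ∧ n ≠ m) := by
  simp only [Tset, Set.mem_union, Set.mem_singleton_iff, Set.mem_Icc, Set.mem_Ici]
  omega

/-- `⟨2, m⟩` as a numerical semigroup, for odd `m`. -/
def gen2Semigroup (m : ℕ) (hm : m % 2 = 1) : NumericalSemigroup where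
  carrier := gen2 m
  zero_mem := ⟨0, 0, by simp⟩
  add_mem := by
    rintro _ _ ⟨a, b, rfl⟩ ⟨c, d, rfl⟩
    exact ⟨a + c, b + d, by ring⟩
  cofinite := (Set.finite_lt_nat m).subset fun n hn => by
    simp only [Set.mem_compl_iff, mem_gen2_iff hm] at hn
    simp only [Set.mem_ofPred_eq]
    omega

/-- `T(m)` as a numerical semigroup, for odd `m`. -/
def TSemigroup (m : ℕ) (hm : m % 2 = 1) : NumericalSemigroup where
  carrier := Tset m
  zero_mem := (mem_Tset_iff (by omega)).2 (Or.inl rfl)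
  add_mem := by
    intro a b
    simp only [mem_Tset_iff (show 1 ≤ m by omega)]
    omega
  cofinite := (Set.finite_le_nat m).subset fun n hn => by
    simp only [Set.mem_compl_iff, mem_Tset_iff (show 1 ≤ m by omega)] at hn
    simp only [Set.mem_ofPred_eq]
    omega

theorem irred_of_carrier_eq_gen2 {m : ℕ} (hm : m % 2 = 1) (hm3 : 3 ≤ m) {A : NumericalSemigroup}
    (hA : A.carrier = gen2 m) : A.Irred := by
  refine .of_forall_ssuperset (f := m - 2) ?_ fun C hC => ?_
  · rw [hA, mem_gen2_iff hm]
    omega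
  · obtain ⟨hsub, x, hxC, hxA⟩ := Set.ssubset_iff_exists.1 hC
    rw [hA, mem_gen2_iff hm] at hxA
    have hd : m - 2 - x ∈ C.carrier := hsub (by rw [hA, mem_gen2_iff hm]; omega)
    have hsum := C.add_mem hxC hd
    rwa [show x + (m - 2 - x) = m - 2 by omega] at hsum

theorem irred_of_carrier_eq_Tset {m : ℕ} (hm : m % 2 = 1) {B : NumericalSemigroup}
    (hB : B.carrier = Tset m) : B.Irred := by
  have hm1 : 1 ≤ m := by omega
  refine .of_forall_ssuperset (f := m) ?_ fun C hC => ?_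
  · rw [hB, mem_Tset_iff hm1]
    omega
  · obtain ⟨hsub, x, hxC, hxB⟩ := Set.ssubset_iff_exists.1 hC
    rw [hB, mem_Tset_iff hm1] at hxB
    have hd : m - x ∈ C.carrier := hsub (by rw [hB, mem_Tset_iff hm1]; omega)
    have hsum := C.add_mem hxC hd
    rwa [show x + (m - x) = m by omega] at hsum

theorem Sset_ssubset_gen2 {m : ℕ} (hm : 5 ≤ m) : Sset m ⊂ gen2 m := by
  refine Set.ssubset_iff_exists.2 ⟨Set.inter_subset_left, 2, ⟨1, 0, by simp⟩, fun h => ?_⟩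
  have hT := (mem_Tset_iff (by omega)).1 h.2
  omega

theorem Sset_ssubset_Tset {m : ℕ} (hm : m % 4 = 3) (hm7 : 7 ≤ m) : Sset m ⊂ Tset m := by
  refine Set.ssubset_iff_exists.2 ⟨Set.inter_subset_right, (m + 1) / 2 + 1,
    (mem_Tset_iff (by omega)).2 (by omega), fun h => ?_⟩
  have hG := (mem_gen2_iff (by omega)).1 h.1
  omega

theorem isFactorization_pair {S A B : NumericalSemigroup} (hA : A.Irred) (hB : B.Irred)
    (hS : S.carrier = A.carrier ∩ B.carrier) (hSA : S.carrier ⊂ A.carrier)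
    (hSB : S.carrier ⊂ B.carrier) : IsFactorization S ![A, B] := by
  refine ⟨Fin.forall_fin_two.2 ⟨hA, hB⟩, ?_, fun J hJ hSJ => ?_⟩
  · ext n
    simp [hS, Fin.forall_fin_two]
  · obtain ⟨j, hj⟩ := (Set.ne_univ_iff_exists_notMem J).1 hJ
    fin_cases j
    · refine hSB.not_subset (hSJ ▸ Set.subset_iInter₂ fun k hk => ?_)
      fin_cases k
      · exact absurd hk hj
      · exact subset_rfl
    · refine hSA.not_subset (hSJ ▸ Set.subset_iInter₂ fun k hk => ?_)
      fin_cases k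
      · exact subset_rfl
      · exact absurd hk hj

theorem two_le_of_hasFactorizationOfLength {S : NumericalSemigroup} (hS : ¬ S.Irred)
    (hne : S.carrier ≠ Set.univ) {n : ℕ} (h : HasFactorizationOfLength S n) : 2 ≤ n := by
  obtain ⟨F, hF, hSF, -⟩ := h
  by_contra! hn
  interval_cases n
  · exact hne (by simpa using hSF)
  · have hcarrier : S.carrier = (F 0).carrier := hSF.trans (iInf_unique _)
    refine hF 0 ?_
    rw [← hcarrier]
    exact not_not.1 hS

/-- For odd `i ≡ 3 (mod 4)`, `i ≥ 7`, `S(i) = ⟨2, i⟩ ∩ T(i)` is a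
factorization of `S(i)` into irreducibles of length `2` (both factors are
irreducible and properly contain `S(i)`), and `min(Lᵐ(S(i))) = 2`. -/
theorem minimal_length_two (i : ℕ) (hi : i % 4 = 3) (hi7 : 7 ≤ i) :
    (∀ A : NumericalSemigroup, A.carrier = gen2 i → A.Irred ∧ Sset i ⊂ A.carrier) ∧
    (∀ B : NumericalSemigroup, B.carrier = Tset i → B.Irred ∧ Sset i ⊂ B.carrier) ∧
    (∀ S A B : NumericalSemigroup, S.carrier = Sset i → A.carrier = gen2 i →
      B.carrier = Tset i → IsFactorization S ![A, B]) ∧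
    (∀ S : NumericalSemigroup, S.carrier = Sset i → IsLeast (LengthSet S) 2) := by
  have hodd : i % 2 = 1 := by omega
  have hSA := Sset_ssubset_gen2 (m := i) (by omega)
  have hSB := Sset_ssubset_Tset hi hi7
  have hfac : ∀ S A B : NumericalSemigroup, S.carrier = Sset i → A.carrier = gen2 i →
      B.carrier = Tset i → IsFactorization S ![A, B] := fun S A B hS hA hB =>
    isFactorization_pair (irred_of_carrier_eq_gen2 hodd (by omega) hA)
      (irred_of_carrier_eq_Tset hodd hB) (by rw [hS, hA, hB]; rfl) (by rwa [hS, hA])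
      (by rwa [hS, hB])
  refine ⟨fun A hA => ⟨irred_of_carrier_eq_gen2 hodd (by omega) hA, hA ▸ hSA⟩,
    fun B hB => ⟨irred_of_carrier_eq_Tset hodd hB, hB ▸ hSB⟩, hfac, fun S hS => ⟨?_, ?_⟩⟩
  · exact ⟨_, hfac S (gen2Semigroup i hodd) (TSemigroup i hodd) hS rfl rfl⟩
  · refine fun n hn => two_le_of_hasFactorizationOfLength (fun hirr => hirr
      ⟨gen2Semigroup i hodd, TSemigroup i hodd, hS ▸ hSA, hS ▸ hSB, hS⟩) ?_ hn
    rw [hS]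
    exact (hSA.trans_subset (Set.subset_univ _)).ne
end
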